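/- Let I_k be the d×d diagonal matrix with first k diagonal entries equal to 1 and the rest 0, and let Î_k be its first k columns (a d×k matrix). For any d×d Hermitian rank-k projection matrix P, there exists a d×k matrix Ŵ with orthonormal columns such that ŴŴ* = P and ‖Ŵ − Î_k‖_F ≤ ‖P − I_k‖_F. -/

import Mathlib

open Matrix

/-- The Frobenius norm of a (possibly rectangular) complex matrix. -/
noncomputable def frobNorm {m n : ℕ} (X : Matrix (Fin m) (Fin n) ℂ) : ℝ :=
  Real.sqrt (∑ i, ∑ j, ‖X i j‖ ^ 2)

theorem Matrix.IsHermitian.exists_unitary_diagonalization {n : ℕ}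
    {H : Matrix (Fin n) (Fin n) ℂ} (hH : H.IsHermitian) :
    ∃ (V : Matrix (Fin n) (Fin n) ℂ) (ev : Fin n → ℝ), Vᴴ * V = 1 ∧
      H = V * diagonal (fun i => (ev i : ℂ)) * Vᴴ ∧
      Vᴴ * H * V = diagonal (fun i => (ev i : ℂ)) ∧
      H.rank = Fintype.card {i // ev i ≠ 0} := by
  have hVV : (hH.eigenvectorUnitary : Matrix (Fin n) (Fin n) ℂ)ᴴ * hH.eigenvectorUnitary = 1 :=
    mem_unitaryGroup_iff'.1 hH.eigenvectorUnitary.2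
  have hspec := hH.spectral_theorem
  rw [Unitary.conjStarAlgAut_apply] at hspec
  have hrank := hH.rank_eq_card_non_zero_eigs
  generalize (hH.eigenvectorUnitary : Matrix (Fin n) (Fin n) ℂ) = V at hVV hspec
  generalize hH.eigenvalues = ev at hspec hrank
  refine ⟨V, ev, hVV, hspec, ?_, hrank⟩
  calc Vᴴ * H * V = (Vᴴ * V) * diagonal (fun i => (ev i : ℂ)) * (Vᴴ * V) := by
        rw [hspec]
        simp only [Matrix.mul_assoc]
        rfl
    _ = diagonal (fun i => (ev i : ℂ)) := by rw [hVV, Matrix.one_mul, Matrix.mul_one]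

theorem exists_isometry_of_projection {d k : ℕ} {P : Matrix (Fin d) (Fin d) ℂ}
    (hPh : P.IsHermitian) (hPproj : P * P = P) (hPrank : P.rank = k) :
    ∃ B : Matrix (Fin d) (Fin k) ℂ, Bᴴ * B = 1 ∧ B * Bᴴ = P := by
  obtain ⟨V, ev, hVV, hspec, hdiag, hrank⟩ := hPh.exists_unitary_diagonalization
  set D : Matrix (Fin d) (Fin d) ℂ := diagonal (fun i => (ev i : ℂ)) with hD
  have hVV' : V * Vᴴ = 1 := mul_eq_one_comm.1 hVV
  have hDD : D * D = D := by
    calc D * D = Vᴴ * P * (V * Vᴴ) * P * V := by rw [← hdiag]; simp only [Matrix.mul_assoc]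
      _ = Vᴴ * (P * P) * V := by rw [hVV']; simp only [Matrix.mul_assoc, Matrix.one_mul]
      _ = D := by rw [hPproj, hdiag]
  have hone : ∀ i, ev i ≠ 0 → (ev i : ℂ) = 1 := by
    intro i hi
    have h := congrFun (congrFun hDD i) i
    simp only [hD, diagonal_mul_diagonal, diagonal_apply_eq] at h
    exact mul_left_cancel₀ (Complex.ofReal_ne_zero.2 hi) (h.trans (mul_one _).symm)
  let e : Fin k ≃ {i // ev i ≠ 0} :=
    (Fintype.equivFinOfCardEq (hrank.symm.trans hPrank)).symm
  have he : Function.Injective (fun l => (e l : Fin d)) :=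
    Subtype.val_injective.comp e.injective
  refine ⟨V.submatrix id (fun l => (e l : Fin d)), ?_, ?_⟩
  · rw [conjTranspose_submatrix, ← submatrix_mul _ _ _ _ _ Function.bijective_id, hVV]
    exact submatrix_one _ he
  · rw [hspec]
    ext i j
    rw [mul_apply, mul_apply]
    simp only [submatrix_apply, id, conjTranspose_apply, hD, mul_diagonal]
    rw [e.sum_comp (fun x => V i x * star (V j x)),
      ← Finset.sum_subtype (Finset.univ.filter fun x => ev x ≠ 0) (by simp)
        (fun x => V i x * star (V j x)), Finset.sum_filter]
    refine Finset.sum_congr rfl fun x _ => ?_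
    split_ifs with hx
    · rw [hone x hx, mul_one]
    · simp [not_not.1 hx]

open scoped ComplexOrder in
/-- For a contraction `M`, some unitary `U` (the adjoint of a unitary polar factor of `M`)
satisfies `tr (M* M) ≤ Re tr (M U)`. -/
theorem exists_unitary_trace_le {k : ℕ} (M : Matrix (Fin k) (Fin k) ℂ)
    (hM : (1 - Mᴴ * M).PosSemidef) :
    ∃ U : Matrix (Fin k) (Fin k) ℂ, Uᴴ * U = 1 ∧ (Mᴴ * M).trace.re ≤ (M * U).trace.re := by
  obtain ⟨V, ev, hVV, hspec, hdiag, -⟩ :=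
    (isHermitian_conjTranspose_mul_self M).exists_unitary_diagonalization
  have hnonneg : ∀ i, 0 ≤ ev i := by
    intro i
    have h := ((posSemidef_conjTranspose_mul_self M).conjTranspose_mul_mul_same V).diag_nonneg
      (i := i)
    rw [hdiag, diagonal_apply_eq] at h
    exact_mod_cast h
  have hle : ∀ i, ev i ≤ 1 := by
    intro i
    have h := (hM.conjTranspose_mul_mul_same V).diag_nonneg (i := i)
    rw [Matrix.mul_sub, Matrix.sub_mul, hdiag, Matrix.mul_one, hVV] at h
    simp only [Matrix.sub_apply, one_apply_eq, diagonal_apply_eq] at h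
    simpa using (Complex.le_def.1 h).1
  set σ : Fin k → ℝ := fun i => Real.sqrt (ev i) with hσ
  have hσsq : ∀ i, σ i * σ i = ev i := fun i => Real.mul_self_sqrt (hnonneg i)
  set A := M * V with hA
  have hAA : ∀ i j, ∑ l, star (A l i) * A l j = if i = j then (ev i : ℂ) else 0 := by
    intro i j
    have h : Aᴴ * A = diagonal (fun i => (ev i : ℂ)) := by
      rw [← hdiag, hA, conjTranspose_mul]
      simp only [Matrix.mul_assoc]
    have := congrFun (congrFun h i) j
    simpa [mul_apply, diagonal_apply] using this
  let u : Fin k → EuclideanSpace ℂ (Fin k) :=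
    fun i => WithLp.toLp 2 (fun l => (σ i : ℂ)⁻¹ * A l i)
  have hu : Orthonormal ℂ (Set.domRestrict {i | σ i ≠ 0} u) := by
    rw [orthonormal_iff_ite]
    rintro ⟨i, hi⟩ ⟨j, hj⟩
    have hi' : (σ i : ℂ) ≠ 0 := Complex.ofReal_ne_zero.2 hi
    have huu : inner ℂ (u i) (u j) =
        (σ i : ℂ)⁻¹ * (σ j : ℂ)⁻¹ * ∑ l, star (A l i) * A l j := by
      simp only [PiLp.inner_apply, u, RCLike.inner_apply, Finset.mul_sum]
      refine Finset.sum_congr rfl fun l _ => ?_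
      simp
      ring
    change inner ℂ (u i) (u j) = _
    rw [huu, hAA]
    simp only [Subtype.mk.injEq]
    split_ifs with h
    · subst h
      rw [← hσsq i]
      push_cast
      field_simp
    · simp
  obtain ⟨b, hb⟩ := hu.exists_orthonormalBasis_extension_of_card_eq (by simp)
  let Q : Matrix (Fin k) (Fin k) ℂ := of fun l i => b i l
  have hQQ : Qᴴ * Q = 1 := by
    ext i j
    have := orthonormal_iff_ite.1 b.orthonormal i j
    simp only [PiLp.inner_apply, RCLike.inner_apply] at this
    simp only [mul_apply, conjTranspose_apply, Q, of_apply, one_apply, ← this]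
    exact Finset.sum_congr rfl fun l _ => mul_comm _ _
  have hQQ' : Q * Qᴴ = 1 := mul_eq_one_comm.1 hQQ
  have hAQ : A = Q * diagonal (fun i => (σ i : ℂ)) := by
    ext l i
    rw [mul_diagonal]
    by_cases hi : σ i = 0
    · have h := hAA i i
      rw [if_pos rfl, ← hσsq i, hi, mul_zero, Complex.ofReal_zero,
        Finset.sum_eq_zero_iff_of_nonneg (fun l _ => star_mul_self_nonneg _)] at h
      have hAl : A l i = 0 := by simpa using h l (Finset.mem_univ l)
      simp [hAl, hi]
    · have hi' : (σ i : ℂ) ≠ 0 := Complex.ofReal_ne_zero.2 hi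
      simp only [Q, of_apply, hb i hi, u]
      field_simp
  refine ⟨V * Qᴴ, ?_, ?_⟩
  · rw [conjTranspose_mul, conjTranspose_conjTranspose, Matrix.mul_assoc, ← Matrix.mul_assoc Vᴴ,
      hVV, Matrix.one_mul, hQQ']
  · have h1 : (M * (V * Qᴴ)).trace = ∑ i, (σ i : ℂ) := by
      rw [← Matrix.mul_assoc, ← hA, hAQ, trace_mul_cycle, hQQ, Matrix.one_mul, trace_diagonal]
    have h2 : (Mᴴ * M).trace = ∑ i, (ev i : ℂ) := by
      rw [hspec, trace_mul_cycle, hVV, Matrix.one_mul, trace_diagonal]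
    rw [h1, h2, ← Complex.ofReal_sum, ← Complex.ofReal_sum, Complex.ofReal_re, Complex.ofReal_re]
    refine Finset.sum_le_sum fun i _ => Real.le_sqrt_of_sq_le ?_
    nlinarith [hnonneg i, hle i]

theorem frobNorm_eq_sqrt_trace {m n : ℕ} (X : Matrix (Fin m) (Fin n) ℂ) :
    frobNorm X = Real.sqrt (Xᴴ * X).trace.re := by
  unfold frobNorm
  congr 1
  rw [Finset.sum_comm]
  simp only [trace, diag_apply, mul_apply, conjTranspose_apply, Complex.re_sum]
  refine Finset.sum_congr rfl fun i _ => Finset.sum_congr rfl fun j _ => ?_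
  rw [← Complex.normSq_eq_norm_sq, Complex.normSq_apply]
  simp

open scoped ComplexOrder in
/-- If `E` and `B` have orthonormal columns, then `B` can be replaced by `B U`, with `U` unitary,
to be as close to `E` as `B B*` is to `E E*` in the Frobenius norm. -/
theorem exists_unitary_frobNorm_sub_le {d k : ℕ} {B E : Matrix (Fin d) (Fin k) ℂ}
    (hB : Bᴴ * B = 1) (hE : Eᴴ * E = 1) :
    ∃ U : Matrix (Fin k) (Fin k) ℂ, Uᴴ * U = 1 ∧
      frobNorm (B * U - E) ≤ frobNorm (B * Bᴴ - E * Eᴴ) := by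
  have hcontr : (1 - (Eᴴ * B)ᴴ * (Eᴴ * B)).PosSemidef := by
    have h : 1 - (Eᴴ * B)ᴴ * (Eᴴ * B) = (B - E * (Eᴴ * B))ᴴ * (B - E * (Eᴴ * B)) := by
      simp only [conjTranspose_sub, conjTranspose_mul, conjTranspose_conjTranspose,
        Matrix.sub_mul, Matrix.mul_sub, hB]
      have h1 : Bᴴ * E * Eᴴ * (E * (Eᴴ * B)) = Bᴴ * E * (Eᴴ * E) * (Eᴴ * B) := by
        simp only [Matrix.mul_assoc]
      rw [h1, hE]
      simp only [Matrix.mul_assoc, Matrix.one_mul]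
      abel
    rw [h]
    exact posSemidef_conjTranspose_mul_self _
  obtain ⟨U, hU, htr⟩ := exists_unitary_trace_le (Eᴴ * B) hcontr
  refine ⟨U, hU, ?_⟩
  rw [frobNorm_eq_sqrt_trace, frobNorm_eq_sqrt_trace]
  refine Real.sqrt_le_sqrt ?_
  have hL : ((B * U - E)ᴴ * (B * U - E)).trace =
      k + k - ((Eᴴ * B * U).trace + star (Eᴴ * B * U).trace) := by
    have h1 : (B * U)ᴴ * (B * U) = 1 := by
      rw [conjTranspose_mul, Matrix.mul_assoc, ← Matrix.mul_assoc Bᴴ, hB, Matrix.one_mul, hU]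
    have h2 : (B * U)ᴴ * E = (Eᴴ * B * U)ᴴ := by
      simp only [conjTranspose_mul, conjTranspose_conjTranspose, Matrix.mul_assoc]
    rw [conjTranspose_sub, Matrix.sub_mul, Matrix.mul_sub, Matrix.mul_sub, h1, hE, h2,
      ← Matrix.mul_assoc Eᴴ]
    simp only [trace_sub, trace_one, Fintype.card_fin, trace_conjTranspose]
    ring
  have hR : ((B * Bᴴ - E * Eᴴ)ᴴ * (B * Bᴴ - E * Eᴴ)).trace =
      k + k - 2 * ((Eᴴ * B)ᴴ * (Eᴴ * B)).trace := by
    have hproj : ∀ C : Matrix (Fin d) (Fin k) ℂ, Cᴴ * C = 1 →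
        (C * Cᴴ * (C * Cᴴ)).trace = k := by
      intro C hC
      rw [Matrix.mul_assoc, ← Matrix.mul_assoc Cᴴ, hC, Matrix.one_mul, trace_mul_comm, hC,
        trace_one, Fintype.card_fin]
    have h3 : (B * Bᴴ * (E * Eᴴ)).trace = ((Eᴴ * B)ᴴ * (Eᴴ * B)).trace := by
      rw [Matrix.mul_assoc, trace_mul_comm]
      simp only [conjTranspose_mul, conjTranspose_conjTranspose, Matrix.mul_assoc]
    have h4 : (E * Eᴴ * (B * Bᴴ)).trace = ((Eᴴ * B)ᴴ * (Eᴴ * B)).trace := by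
      rw [trace_mul_comm, h3]
    simp only [conjTranspose_sub, conjTranspose_mul, conjTranspose_conjTranspose,
      Matrix.sub_mul, Matrix.mul_sub (_ * _), trace_sub, hproj B hB, hproj E hE, h3, h4]
    ring
  rw [hL, hR]
  simp only [Complex.sub_re, Complex.add_re, Complex.mul_re, Complex.star_def, Complex.conj_re,
    Complex.re_ofNat, Complex.im_ofNat]
  linarith

theorem conjTranspose_mul_self_firstColumns {d k : ℕ} (hkd : k ≤ d) :
    (of fun (i : Fin d) (j : Fin k) => if (i : ℕ) = (j : ℕ) then (1 : ℂ) else 0)ᴴ *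
      (of fun (i : Fin d) (j : Fin k) => if (i : ℕ) = (j : ℕ) then (1 : ℂ) else 0) = 1 := by
  ext a b
  simp only [mul_apply, conjTranspose_apply, of_apply, one_apply]
  rw [Finset.sum_eq_single (Fin.castLE hkd a)]
  · simp [Fin.ext_iff]
  · intro c _ hc
    have : (c : ℕ) ≠ a := fun h => hc (Fin.ext h)
    simp [this]
  · simp

theorem firstColumns_mul_conjTranspose_self (d k : ℕ) :
    (of fun (i : Fin d) (j : Fin k) => if (i : ℕ) = (j : ℕ) then (1 : ℂ) else 0) *
      (of fun (i : Fin d) (j : Fin k) => if (i : ℕ) = (j : ℕ) then (1 : ℂ) else 0)ᴴ =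
    diagonal (fun i : Fin d => if (i : ℕ) < k then (1 : ℂ) else 0) := by
  ext a b
  simp only [mul_apply, conjTranspose_apply, of_apply, diagonal_apply]
  by_cases ha : (a : ℕ) < k
  · rw [Finset.sum_eq_single ⟨a, ha⟩]
    · simp [Fin.ext_iff, ha, eq_comm]
    · intro c _ hc
      have : (a : ℕ) ≠ c := fun h => hc (Fin.ext h.symm)
      simp [this]
    · simp
  · rw [Finset.sum_eq_zero]
    · simp [ha]
    · intro c _
      have : (a : ℕ) ≠ c := by omega
      simp [this]

/-- Let `I_k` be the `d×d` diagonal matrix with first `k` diagonal entries `1` and the rest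
`0`, and `Î_k` its first `k` columns. For any `d×d` Hermitian rank-`k` projection `P` there
is a `d×k` matrix `Ŵ` with orthonormal columns such that `ŴŴ* = P` and
`‖Ŵ − Î_k‖_F ≤ ‖P − I_k‖_F`. -/
theorem exists_orthonormal_basis_close_to_identity {d k : ℕ} (hkd : k ≤ d)
    (P : Matrix (Fin d) (Fin d) ℂ)
    (hPh : P.IsHermitian) (hPproj : P * P = P) (hPrank : P.rank = k) :
    ∃ W : Matrix (Fin d) (Fin k) ℂ,
      Wᴴ * W = 1 ∧ W * Wᴴ = P ∧
      frobNorm (W - (Matrix.of fun (i : Fin d) (j : Fin k) => if (i : ℕ) = (j : ℕ) then (1 : ℂ) else 0))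
        ≤ frobNorm (P - Matrix.diagonal (fun i : Fin d => if (i : ℕ) < k then (1 : ℂ) else 0)) := by
  obtain ⟨B, hB, hBP⟩ := exists_isometry_of_projection hPh hPproj hPrank
  obtain ⟨U, hU, hle⟩ :=
    exists_unitary_frobNorm_sub_le hB (conjTranspose_mul_self_firstColumns hkd)
  refine ⟨B * U, ?_, ?_, ?_⟩
  · rw [conjTranspose_mul, Matrix.mul_assoc, ← Matrix.mul_assoc Bᴴ, hB, Matrix.one_mul, hU]
  · rw [conjTranspose_mul, Matrix.mul_assoc, ← Matrix.mul_assoc U, mul_eq_one_comm.1 hU,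
      Matrix.one_mul, hBP]
  · rwa [hBP, firstColumns_mul_conjTranspose_self] at hle
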